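/- arXiv:1304.0177 — 8 statements merged into one kernel-verified Lean document; each statement's English description precedes it below -/
import Mathlib

section
/- Let R be an associative ring with 1 (not necessarily commutative). For all t₁, t₂ ∈ R, the solution set {(x,y) ∈ R^2 | (t₂*t₁ - 1)*x + t₂*y = 0} equals {(-t₂*r, (t₁*t₂ - 1)*r) | r ∈ R}. -/
/-- For `t₁, t₂ ∈ R`, the solution set of
`(t₂*t₁ - 1)*x + t₂*y = 0` equals `{(-t₂*r, (t₁*t₂ - 1)*r) | r ∈ R}`. -/
theorem perp_point_n_two (R : Type*) [Ring R] (t₁ t₂ : R) :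
    {p : R × R | (t₂ * t₁ - 1) * p.1 + t₂ * p.2 = 0} =
      {p : R × R | ∃ r : R, p = (-t₂ * r, (t₁ * t₂ - 1) * r)} := by
  ext ⟨x, y⟩
  simp only [Set.mem_ofPred_eq, Prod.mk.injEq]
  constructor
  · intro h
    have hx : t₂ * (t₁ * x + y) = x := by
      rw [← sub_eq_zero, ← h]
      noncomm_ring
    refine ⟨-(t₁ * x + y), by rw [neg_mul_neg, hx], ?_⟩
    rw [mul_neg, sub_mul, mul_assoc, hx]
    noncomm_ring
  · rintro ⟨r, rfl, rfl⟩
    noncomm_ring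
end

section
/- Let R be an associative ring with 1 (not necessarily commutative). For all t₁, t₂, t₃ ∈ R, the solution set {(x,y) ∈ R^2 | (t₃*t₂*t₁ - t₃ - t₁)*x + (t₃*t₂ - 1)*y = 0} equals {((-t₂*t₃ + 1)*r, (t₁*t₂*t₃ - t₁ - t₃)*r) | r ∈ R}. -/
/-- For `t₁, t₂, t₃ ∈ R`, the solution set of
`(t₃*t₂*t₁ - t₃ - t₁)*x + (t₃*t₂ - 1)*y = 0` equals
`{((-t₂*t₃ + 1)*r, (t₁*t₂*t₃ - t₁ - t₃)*r) | r ∈ R}`. -/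
theorem perp_point_n_three (R : Type*) [Ring R] (t₁ t₂ t₃ : R) :
    {p : R × R | (t₃ * t₂ * t₁ - t₃ - t₁) * p.1 + (t₃ * t₂ - 1) * p.2 = 0} =
      {p : R × R | ∃ r : R,
        p = ((-t₂ * t₃ + 1) * r, (t₁ * t₂ * t₃ - t₁ - t₃) * r)} := by
  ext ⟨x, y⟩
  simp only [Set.mem_ofPred_eq, Prod.mk.injEq]
  constructor
  · intro h
    refine ⟨x - t₂ * (t₁ * x + y), ?_, ?_⟩
    · have h₂ : t₂ * ((t₃ * t₂ * t₁ - t₃ - t₁) * x + (t₃ * t₂ - 1) * y) = 0 := by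
        rw [h, mul_zero]
      rw [← sub_eq_zero, ← neg_eq_zero, ← h₂]
      noncomm_ring
    · have h₁ : (t₁ * t₂ - 1) * ((t₃ * t₂ * t₁ - t₃ - t₁) * x + (t₃ * t₂ - 1) * y) = 0 := by
        rw [h, mul_zero]
      rw [← sub_eq_zero, ← h₁]
      noncomm_ring
  · rintro ⟨r, rfl, rfl⟩
    noncomm_ring
end

section
/- Let R be an associative ring with 1 (not necessarily commutative), n ≥ 0, and t₁,…,tₙ ∈ R. Set E(t) := [[t,1],[-1,0]], let (a,b) := (1,0)·E(tₙ)·E(tₙ₋₁)⋯E(t₁) (row vector times the matrix product), and let (v,w) be the column vector (E(0)·E(-t₁)·E(-t₂)⋯E(-tₙ)·E(0))·(0,1)ᵀ. Then {(x,y) ∈ R^2 | a*x + b*y = 0} = {(v*r, w*r) | r ∈ R}. -/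
/-- The matrix `E(t) = [[t,1],[-1,0]]` over a ring `R`. -/
def Emat {R : Type*} [Ring R] (t : R) : Matrix (Fin 2) (Fin 2) R :=
  !![t, 1; -1, 0]

/-- Inverting a matrix whose first row is `(a, b)` shows that the solutions of `a * x + b * y = 0`
are the right multiples of the second column of the inverse. -/
theorem Matrix.fin_two_row_eq_zero_iff {R : Type*} [Ring R] {P Q : Matrix (Fin 2) (Fin 2) R}
    (hPQ : P * Q = 1) (hQP : Q * P = 1) (x y : R) :
    P 0 0 * x + P 0 1 * y = 0 ↔ ∃ r, x = Q 0 1 * r ∧ y = Q 1 1 * r := by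
  constructor
  · intro h
    have hv : P.mulVec ![x, y] = ![0, P 1 0 * x + P 1 1 * y] := by
      ext i
      fin_cases i <;> simp [Matrix.mulVec, dotProduct, Fin.sum_univ_two, h]
    have hQ : ![x, y] = Q.mulVec ![0, P 1 0 * x + P 1 1 * y] := by
      rw [← hv, Matrix.mulVec_mulVec, hQP, Matrix.one_mulVec]
    refine ⟨P 1 0 * x + P 1 1 * y, ?_, ?_⟩
    · simpa [Matrix.mulVec, dotProduct, Fin.sum_univ_two] using congrFun hQ 0
    · simpa [Matrix.mulVec, dotProduct, Fin.sum_univ_two] using congrFun hQ 1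
  · rintro ⟨r, rfl, rfl⟩
    have h : P 0 0 * Q 0 1 + P 0 1 * Q 1 1 = 0 := by
      simpa [Matrix.mul_apply, Fin.sum_univ_two] using congrFun (congrFun hPQ 0) 1
    rw [← mul_assoc, ← mul_assoc, ← add_mul, h, zero_mul]

theorem Emat_zero_mul_Emat_zero {R : Type*} [Ring R] :
    (Emat 0 : Matrix (Fin 2) (Fin 2) R) * Emat 0 = -1 := by
  ext i j
  fin_cases i <;> fin_cases j <;> simp [Emat, Matrix.mul_apply, Fin.sum_univ_two]

theorem Emat_mul_conj {R : Type*} [Ring R] (t : R) :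
    Emat t * (Emat 0 * Emat (-t) * Emat 0) = 1 := by
  ext i j
  fin_cases i <;> fin_cases j <;> simp [Emat, Matrix.mul_apply, Fin.sum_univ_two]

theorem Emat_conj_mul {R : Type*} [Ring R] (t : R) :
    Emat 0 * Emat (-t) * Emat 0 * Emat t = 1 := by
  ext i j
  fin_cases i <;> fin_cases j <;> simp [Emat, Matrix.mul_apply, Fin.sum_univ_two]

theorem Emat_zero_mul_mul_mul_Emat_zero {R : Type*} [Ring R] (A B : Matrix (Fin 2) (Fin 2) R) :
    Emat 0 * (A * B) * Emat 0 = -((Emat 0 * A * Emat 0) * (Emat 0 * B * Emat 0)) := by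
  calc Emat 0 * (A * B) * Emat 0 = -(Emat 0 * A * (-1) * B * Emat 0) := by simp [mul_assoc]
    _ = _ := by rw [← Emat_zero_mul_Emat_zero]; simp only [mul_assoc]

/-- Up to sign, the two products of the matrices `E(t)` are inverse to each other. -/
theorem Emat_list_prod_inverse {R : Type*} [Ring R] (l : List R) :
    let P := (l.map Emat).reverse.prod
    let Q := Emat 0 * (l.map fun t => Emat (-t)).prod * Emat 0
    (P * Q = 1 ∧ Q * P = 1) ∨ (P * Q = -1 ∧ Q * P = -1) := by
  intro P Q
  induction l with
  | nil => right; simp [P, Q, Emat_zero_mul_Emat_zero]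
  | cons t l ih =>
    set P' := (l.map Emat).reverse.prod with hP'
    set Q' := Emat 0 * (l.map fun t => Emat (-t)).prod * Emat 0 with hQ'
    have hP : P = P' * Emat t := by simp [P, hP']
    have hQ : Q = -((Emat 0 * Emat (-t) * Emat 0) * Q') := by
      simp only [Q, hQ', List.map_cons, List.prod_cons, Emat_zero_mul_mul_mul_Emat_zero]
    have hPQ : P * Q = -(P' * Q') := by
      rw [hP, hQ, mul_neg, mul_assoc P', ← mul_assoc (Emat t), Emat_mul_conj, one_mul]
    have hQP (s : Matrix (Fin 2) (Fin 2) R) (hs : Q' * P' = s) (hc : Commute s (Emat t)) :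
        Q * P = -s := by
      rw [hP, hQ, neg_mul, mul_assoc, ← mul_assoc Q', hs, hc.eq, ← mul_assoc, Emat_conj_mul,
        one_mul]
    rcases ih with ⟨h₁, h₂⟩ | ⟨h₁, h₂⟩
    · exact Or.inr ⟨by rw [hPQ, h₁], hQP 1 h₂ (Commute.one_left _)⟩
    · exact Or.inl ⟨by rw [hPQ, h₁, neg_neg],
        by rw [hQP (-1) h₂ (Commute.one_left _).neg_left, neg_neg]⟩

/-- For `t₁,…,tₙ ∈ R`, let `(a,b) := (1,0)·E(tₙ)·E(tₙ₋₁)⋯E(t₁)`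
and `(v,w)ᵀ := (E(0)·E(-t₁)·E(-t₂)⋯E(-tₙ)·E(0))·(0,1)ᵀ`.  Then the solution
set of `a*x + b*y = 0` equals `{(v*r, w*r) | r ∈ R}`.
Here `t i = tᵢ₊₁` for `i : Fin n`. -/
theorem perp_point_general (R : Type*) [Ring R] (n : ℕ) (t : Fin n → R) :
    let P : Matrix (Fin 2) (Fin 2) R := ((List.ofFn fun i => Emat (t i)).reverse).prod
    let ab : Fin 2 → R := Matrix.vecMul ![1, 0] P
    let Q : Matrix (Fin 2) (Fin 2) R :=
      Emat 0 * (List.ofFn fun i => Emat (-(t i))).prod * Emat 0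
    let vw : Fin 2 → R := Matrix.mulVec Q ![0, 1]
    {p : R × R | ab 0 * p.1 + ab 1 * p.2 = 0} =
      {p : R × R | ∃ r : R, p = (vw 0 * r, vw 1 * r)} := by
  intro P ab Q vw
  have ha (i : Fin 2) : ab i = P 0 i := by
    simp [ab, Matrix.vecMul, dotProduct, Fin.sum_univ_two]
  have hv (i : Fin 2) : vw i = Q i 1 := by
    fin_cases i <;> simp [vw]
  have key : (P * Q = 1 ∧ Q * P = 1) ∨ (P * Q = -1 ∧ Q * P = -1) := by
    simpa only [List.map_ofFn, Function.comp_def] using Emat_list_prod_inverse (List.ofFn t)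
  ext ⟨x, y⟩
  simp only [Set.mem_ofPred_eq, ha, hv, Prod.mk.injEq]
  rcases key with ⟨h₁, h₂⟩ | ⟨h₁, h₂⟩
  · exact Matrix.fin_two_row_eq_zero_iff h₁ h₂ x y
  · rw [← Matrix.fin_two_row_eq_zero_iff (P := -P) (by rw [neg_mul, h₁, neg_neg])
      (by rw [mul_neg, h₂, neg_neg]) x y]
    simp only [Matrix.neg_apply, neg_mul, ← neg_add, neg_eq_zero]
end

section
/- Let R be an associative ring with 1 (not necessarily commutative) and let M, N ∈ GL₂(R), with first rows (a,b) and (c,d) respectively. If the solution sets {(x,y) ∈ R^2 | a*x + b*y = 0} and {(x,y) ∈ R^2 | c*x + d*y = 0} coincide, then the cyclic left submodules R·(a,b) and R·(c,d) of the left R-module R^2 coincide. -/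
/-- If every solution of `a * x + b * y = 0`, with `(a, b)` the first row of an invertible matrix,
also solves `c * x + d * y = 0`, then `(c, d)` is a left multiple of `(a, b)`. -/
theorem exists_eq_mul_row_of_perp_subset {R : Type*} [Ring R]
    (M : Matrix (Fin 2) (Fin 2) R) [Invertible M] (c d : R)
    (h : ∀ x y : R, M 0 0 * x + M 0 1 * y = 0 → c * x + d * y = 0) :
    ∃ s : R, c = s * M 0 0 ∧ d = s * M 0 1 := by
  have hr (i j : Fin 2) := congrFun (congrFun (mul_invOf_self M) i) j
  have hl (i j : Fin 2) := congrFun (congrFun (invOf_mul_self M) i) j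
  simp only [Matrix.mul_apply, Fin.sum_univ_two] at hr hl
  generalize ⅟M = P at hr hl
  have hs := h (P 0 1) (P 1 1) (by simpa using hr 0 1)
  have row (j : Fin 2) : c * (1 : Matrix (Fin 2) (Fin 2) R) 0 j +
      d * (1 : Matrix (Fin 2) (Fin 2) R) 1 j = (c * P 0 0 + d * P 1 0) * M 0 j := by
    calc
      _ = (c * P 0 0 + d * P 1 0) * M 0 j + (c * P 0 1 + d * P 1 1) * M 1 j := by
        rw [← hl 0 j, ← hl 1 j]
        noncomm_ring
      _ = _ := by rw [hs, zero_mul, add_zero]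
  exact ⟨c * P 0 0 + d * P 1 0, by simpa using row 0, by simpa using row 1⟩

/-- If two admissible rows `(a,b)` (first row of invertible `M`)
and `(c,d)` (first row of invertible `N`) have the same solution set
`{(x,y) | a*x + b*y = 0}`, then they span the same cyclic left submodule
`R·(a,b) = R·(c,d)` of `R²`. -/
theorem row_eq_of_perp_eq (R : Type*) [Ring R]
    (M N : Matrix (Fin 2) (Fin 2) R) [Invertible M] [Invertible N]
    (h : {p : R × R | M 0 0 * p.1 + M 0 1 * p.2 = 0} =
         {p : R × R | N 0 0 * p.1 + N 0 1 * p.2 = 0}) :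
    {p : R × R | ∃ r : R, p = (r * M 0 0, r * M 0 1)} =
      {p : R × R | ∃ r : R, p = (r * N 0 0, r * N 0 1)} := by
  obtain ⟨s, hs₀, hs₁⟩ := exists_eq_mul_row_of_perp_subset M (N 0 0) (N 0 1)
    fun x y hxy => (Set.ext_iff.mp h (x, y)).mp hxy
  obtain ⟨t, ht₀, ht₁⟩ := exists_eq_mul_row_of_perp_subset N (M 0 0) (M 0 1)
    fun x y hxy => (Set.ext_iff.mp h (x, y)).mpr hxy
  ext p
  constructor
  · rintro ⟨r, rfl⟩
    exact ⟨r * t, by rw [mul_assoc, mul_assoc, ← ht₀, ← ht₁]⟩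
  · rintro ⟨r, rfl⟩
    exact ⟨r * s, by rw [mul_assoc, mul_assoc, ← hs₀, ← hs₁]⟩
end

section
/- Let R be an associative ring with 1 (not necessarily commutative). Let ℙ(R) be the set of all left submodules p of R^2 of the form p = R·(a,b) where (a,b) is the first row of some matrix in GL₂(R), and let ℙ̂(R) be the set of all subsets S of R^2 of the form S = {(N₀₁·r, N₁₁·r) | r ∈ R} where (N₀₁, N₁₁) is the second column of some matrix N ∈ GL₂(R). Then the map sending p ∈ ℙ(R) to its perp p^⊥ := {(x,y) ∈ R^2 | a*x + b*y = 0 for all (a,b) ∈ p} is a well-defined bijection from ℙ(R) onto ℙ̂(R). -/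
/-- The right annihilator of the left span of the first row of an invertible matrix is the set
of right multiples of the second column of its inverse. -/
theorem perp_row_eq_col {R : Type*} [Ring R] {M N : Matrix (Fin 2) (Fin 2) R}
    (hMN : M * N = 1) (hNM : N * M = 1) :
    {v : R × R | ∀ u ∈ {q : R × R | ∃ r : R, q = (r * M 0 0, r * M 0 1)},
      u.1 * v.1 + u.2 * v.2 = 0} =
    {q : R × R | ∃ r : R, q = (N 0 1 * r, N 1 1 * r)} := by
  have h01 : M 0 0 * N 0 1 + M 0 1 * N 1 1 = 0 := by
    simpa [Matrix.mul_apply] using congrFun₂ hMN 0 1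
  have k00 : N 0 0 * M 0 0 + N 0 1 * M 1 0 = 1 := by
    simpa [Matrix.mul_apply] using congrFun₂ hNM 0 0
  have k01 : N 0 0 * M 0 1 + N 0 1 * M 1 1 = 0 := by
    simpa [Matrix.mul_apply] using congrFun₂ hNM 0 1
  have k10 : N 1 0 * M 0 0 + N 1 1 * M 1 0 = 0 := by
    simpa [Matrix.mul_apply] using congrFun₂ hNM 1 0
  have k11 : N 1 0 * M 0 1 + N 1 1 * M 1 1 = 1 := by
    simpa [Matrix.mul_apply] using congrFun₂ hNM 1 1
  ext ⟨x, y⟩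
  constructor
  · intro h
    have h0 : M 0 0 * x + M 0 1 * y = 0 := h (M 0 0, M 0 1) ⟨1, by simp⟩
    refine ⟨M 1 0 * x + M 1 1 * y, Prod.ext ?_ ?_⟩
    · calc x = (N 0 0 * M 0 0 + N 0 1 * M 1 0) * x + (N 0 0 * M 0 1 + N 0 1 * M 1 1) * y := by
            simp [k00, k01]
        _ = N 0 0 * (M 0 0 * x + M 0 1 * y) + N 0 1 * (M 1 0 * x + M 1 1 * y) := by noncomm_ring
        _ = N 0 1 * (M 1 0 * x + M 1 1 * y) := by simp [h0]
    · calc y = (N 1 0 * M 0 0 + N 1 1 * M 1 0) * x + (N 1 0 * M 0 1 + N 1 1 * M 1 1) * y := by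
            simp [k10, k11]
        _ = N 1 0 * (M 0 0 * x + M 0 1 * y) + N 1 1 * (M 1 0 * x + M 1 1 * y) := by noncomm_ring
        _ = N 1 1 * (M 1 0 * x + M 1 1 * y) := by simp [h0]
  · rintro ⟨r, hr⟩ _ ⟨s, rfl⟩
    obtain ⟨rfl, rfl⟩ := Prod.mk.inj hr
    calc s * M 0 0 * (N 0 1 * r) + s * M 0 1 * (N 1 1 * r)
        = s * (M 0 0 * N 0 1 + M 0 1 * N 1 1) * r := by noncomm_ring
      _ = 0 := by simp [h01]

/-- The left annihilator of the right span of the second column of an invertible matrix is the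
set of left multiples of the first row of its inverse. -/
theorem leftPerp_col_eq_row {R : Type*} [Ring R] {M N : Matrix (Fin 2) (Fin 2) R}
    (hMN : M * N = 1) (hNM : N * M = 1) :
    {u : R × R | ∀ v ∈ {q : R × R | ∃ r : R, q = (N 0 1 * r, N 1 1 * r)},
      u.1 * v.1 + u.2 * v.2 = 0} =
    {q : R × R | ∃ r : R, q = (r * M 0 0, r * M 0 1)} := by
  have h01 : M 0 0 * N 0 1 + M 0 1 * N 1 1 = 0 := by
    simpa [Matrix.mul_apply] using congrFun₂ hMN 0 1
  have k00 : N 0 0 * M 0 0 + N 0 1 * M 1 0 = 1 := by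
    simpa [Matrix.mul_apply] using congrFun₂ hNM 0 0
  have k01 : N 0 0 * M 0 1 + N 0 1 * M 1 1 = 0 := by
    simpa [Matrix.mul_apply] using congrFun₂ hNM 0 1
  have k10 : N 1 0 * M 0 0 + N 1 1 * M 1 0 = 0 := by
    simpa [Matrix.mul_apply] using congrFun₂ hNM 1 0
  have k11 : N 1 0 * M 0 1 + N 1 1 * M 1 1 = 1 := by
    simpa [Matrix.mul_apply] using congrFun₂ hNM 1 1
  ext ⟨x, y⟩
  constructor
  · intro h
    have h0 : x * N 0 1 + y * N 1 1 = 0 := h (N 0 1, N 1 1) ⟨1, by simp⟩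
    refine ⟨x * N 0 0 + y * N 1 0, Prod.ext ?_ ?_⟩
    · calc x = x * (N 0 0 * M 0 0 + N 0 1 * M 1 0) + y * (N 1 0 * M 0 0 + N 1 1 * M 1 0) := by
            simp [k00, k10]
        _ = (x * N 0 0 + y * N 1 0) * M 0 0 + (x * N 0 1 + y * N 1 1) * M 1 0 := by noncomm_ring
        _ = (x * N 0 0 + y * N 1 0) * M 0 0 := by simp [h0]
    · calc y = x * (N 0 0 * M 0 1 + N 0 1 * M 1 1) + y * (N 1 0 * M 0 1 + N 1 1 * M 1 1) := by
            simp [k01, k11]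
        _ = (x * N 0 0 + y * N 1 0) * M 0 1 + (x * N 0 1 + y * N 1 1) * M 1 1 := by noncomm_ring
        _ = (x * N 0 0 + y * N 1 0) * M 0 1 := by simp [h0]
  · rintro ⟨s, hs⟩ _ ⟨r, rfl⟩
    obtain ⟨rfl, rfl⟩ := Prod.mk.inj hs
    calc s * M 0 0 * (N 0 1 * r) + s * M 0 1 * (N 1 1 * r)
        = s * (M 0 0 * N 0 1 + M 0 1 * N 1 1) * r := by noncomm_ring
      _ = 0 := by simp [h01]

/-- The perp map `p ↦ p^⊥` is a well-defined bijection from the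
projective line `ℙ(R)` (cyclic left submodules spanned by the first row of an
invertible 2×2 matrix) onto the dual projective line `ℙ̂(R)` (sets of right
multiples of the second column of an invertible 2×2 matrix). -/
theorem perp_bijOn_projectiveLine (R : Type*) [Ring R] :
    Set.BijOn
      (fun p : Set (R × R) =>
        {v : R × R | ∀ u ∈ p, u.1 * v.1 + u.2 * v.2 = 0})
      {p : Set (R × R) | ∃ M : Matrix (Fin 2) (Fin 2) R, IsUnit M ∧
        p = {q : R × R | ∃ r : R, q = (r * M 0 0, r * M 0 1)}}
      {s : Set (R × R) | ∃ N : Matrix (Fin 2) (Fin 2) R, IsUnit N ∧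
        s = {q : R × R | ∃ r : R, q = (N 0 1 * r, N 1 1 * r)}} := by
  refine Set.InvOn.bijOn
    (f' := fun s => {u : R × R | ∀ v ∈ s, u.1 * v.1 + u.2 * v.2 = 0}) ⟨?_, ?_⟩ ?_ ?_
  · rintro _ ⟨_, ⟨U, rfl⟩, rfl⟩
    dsimp only
    rw [perp_row_eq_col U.mul_inv U.inv_mul, leftPerp_col_eq_row U.mul_inv U.inv_mul]
  · rintro _ ⟨_, ⟨U, rfl⟩, rfl⟩
    dsimp only
    rw [leftPerp_col_eq_row U.inv_mul U.mul_inv, perp_row_eq_col U.inv_mul U.mul_inv]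
  · rintro _ ⟨_, ⟨U, rfl⟩, rfl⟩
    exact ⟨_, U⁻¹.isUnit, perp_row_eq_col U.mul_inv U.inv_mul⟩
  · rintro _ ⟨_, ⟨U, rfl⟩, rfl⟩
    exact ⟨_, U⁻¹.isUnit, leftPerp_col_eq_row U.inv_mul U.mul_inv⟩
end

section
/- Let R be an associative ring with 1 (not necessarily commutative) and let P ∈ GL₂(R). Then the entry P₀₁ (first row, second column of P) is a unit of R if and only if the entry (P⁻¹)₀₁ of the inverse matrix is a unit of R. -/
/-- If `P` and `Q` are mutually inverse 2×2 matrices and `P₀₁` is a unit, then so is `Q₀₁`,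
with inverse the Schur complement `P₁₀ - P₁₁ P₀₁⁻¹ P₀₀`. -/
theorem isUnit_apply_zero_one_of_mul_eq_one {R : Type*} [Ring R]
    {P Q : Matrix (Fin 2) (Fin 2) R} (hPQ : P * Q = 1) (hQP : Q * P = 1)
    (h : IsUnit (P 0 1)) : IsUnit (Q 0 1) := by
  obtain ⟨u, hu⟩ := h
  have h₁ : P 0 0 * Q 0 1 + u * Q 1 1 = 0 := by
    simpa [Matrix.mul_apply, Fin.sum_univ_two, hu] using congrFun₂ hPQ 0 1
  have h₂ : P 1 0 * Q 0 1 + P 1 1 * Q 1 1 = 1 := by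
    simpa [Matrix.mul_apply, Fin.sum_univ_two] using congrFun₂ hPQ 1 1
  have h₃ : Q 0 0 * P 0 0 + Q 0 1 * P 1 0 = 1 := by
    simpa [Matrix.mul_apply, Fin.sum_univ_two] using congrFun₂ hQP 0 0
  have h₄ : Q 0 0 * u + Q 0 1 * P 1 1 = 0 := by
    simpa [Matrix.mul_apply, Fin.sum_univ_two, hu] using congrFun₂ hQP 0 1
  have hQ₁₁ : Q 1 1 = -(↑u⁻¹ * (P 0 0 * Q 0 1)) := by
    rw [← mul_neg, Units.eq_inv_mul_iff_mul_eq]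
    exact eq_neg_of_add_eq_zero_right h₁
  have hQ₀₀ : Q 0 0 = -(Q 0 1 * P 1 1 * ↑u⁻¹) := by
    rw [← neg_mul, Units.eq_mul_inv_iff_mul_eq]
    exact eq_neg_of_add_eq_zero_left h₄
  refine isUnit_iff_exists.mpr ⟨P 1 0 - P 1 1 * ↑u⁻¹ * P 0 0, ?_, ?_⟩
  · rw [← h₃, hQ₀₀]
    noncomm_ring
  · rw [← h₂, hQ₁₁]
    noncomm_ring

/-- For an invertible 2×2 matrix `P` over a ring `R`, the entry
`P₀₁` is a unit of `R` iff the entry `(P⁻¹)₀₁` is a unit of `R`. -/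
theorem isUnit_entry_iff_isUnit_inv_entry (R : Type*) [Ring R]
    (P : Matrix (Fin 2) (Fin 2) R) [Invertible P] :
    IsUnit (P 0 1) ↔ IsUnit ((⅟P) 0 1) :=
  ⟨isUnit_apply_zero_one_of_mul_eq_one (mul_invOf_self P) (invOf_mul_self P),
    isUnit_apply_zero_one_of_mul_eq_one (invOf_mul_self P) (mul_invOf_self P)⟩
end

section
/- Let R be a nontrivial associative ring with 1 (not necessarily commutative) and let K be a subring of R such that every nonzero element x of K has a two-sided inverse in R that again lies in K (i.e., K is a subfield of R). Let a, c ∈ R and let u be a unit of R. If the set K·a + c := {k*a + c | k ∈ K} contains both 0 and u, then K·a + c = K·u := {k*u | k ∈ K}. -/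
/-- Let `K` be a subfield of a nontrivial ring `R` (a subring in
which every nonzero element has a two-sided inverse lying in `K`).  If the set
`K·a + c` contains `0` and a unit `u`, then `K·a + c = K·u`. -/
theorem block_through_zero_and_unit (R : Type*) [Ring R] [Nontrivial R]
    (K : Subring R) (hK : ∀ x ∈ K, x ≠ 0 → ∃ y ∈ K, x * y = 1 ∧ y * x = 1)
    (a c u : R) (hu : IsUnit u)
    (h0 : (0 : R) ∈ {z : R | ∃ k ∈ K, z = k * a + c})
    (hu' : u ∈ {z : R | ∃ k ∈ K, z = k * a + c}) :
    {z : R | ∃ k ∈ K, z = k * a + c} = {z : R | ∃ k ∈ K, z = k * u} := by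
  obtain ⟨k₀, hk₀, h0⟩ := h0
  obtain ⟨k₁, hk₁, hu'⟩ := hu'
  obtain rfl : c = -(k₀ * a) := eq_neg_of_add_eq_zero_right h0.symm
  have hua : u = (k₁ - k₀) * a := by rw [hu', sub_mul, sub_eq_add_neg]
  have hd : k₁ - k₀ ≠ 0 := fun h => hu.ne_zero (by rw [hua, h, zero_mul])
  obtain ⟨e, he, -, hed⟩ := hK _ (K.sub_mem hk₁ hk₀) hd
  have hau : e * u = a := by rw [hua, ← mul_assoc, hed, one_mul]
  ext z
  constructor
  · rintro ⟨k, hk, rfl⟩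
    refine ⟨(k - k₀) * e, K.mul_mem (K.sub_mem hk hk₀) he, ?_⟩
    rw [mul_assoc, hau, sub_mul, sub_eq_add_neg]
  · rintro ⟨k, hk, rfl⟩
    refine ⟨k * (k₁ - k₀) + k₀, K.add_mem (K.mul_mem hk (K.sub_mem hk₁ hk₀)) hk₀, ?_⟩
    rw [add_mul, add_neg_cancel_right, mul_assoc, ← hua]
end

section
/- Let R be a nontrivial associative ring with 1 (not necessarily commutative) and let K be a subring of R such that every nonzero element x of K has a two-sided inverse in R that again lies in K (i.e., K is a subfield of R). Let u be a unit of R such that u·K := {u*k | k ∈ K} is different from K·u := {k*u | k ∈ K}. Then for every unit a of R and every c ∈ R, the set u·K is different from K·a + c := {k*a + c | k ∈ K}. (Geometrically: the block u·K through 0 and u does not belong to the compatibility class {K·a + c | a ∈ R*, c ∈ R} of the block K.) -/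
/-- Let `K` be a subfield of a nontrivial ring `R` and `u` a unit
of `R` with `u·K ≠ K·u`.  Then `u·K` differs from every set `K·a + c` with `a`
a unit and `c ∈ R`; i.e., the block `u·K` does not belong to the compatibility
class of the block `K`. -/
theorem uK_not_in_compatibility_class (R : Type*) [Ring R] [Nontrivial R]
    (K : Subring R) (hK : ∀ x ∈ K, x ≠ 0 → ∃ y ∈ K, x * y = 1 ∧ y * x = 1)
    (u : R) (hu : IsUnit u)
    (hne : {z : R | ∃ k ∈ K, z = u * k} ≠ {z : R | ∃ k ∈ K, z = k * u}) :
    ∀ a c : R, IsUnit a →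
      {z : R | ∃ k ∈ K, z = u * k} ≠ {z : R | ∃ k ∈ K, z = k * a + c} := by
  intro a c _ heq
  apply hne
  have hmem (z : R) : (∃ k ∈ K, z = u * k) ↔ ∃ k ∈ K, z = k * a + c := Set.ext_iff.mp heq z
  obtain ⟨m, hm, hmc⟩ := (hmem 0).mp ⟨0, K.zero_mem, by simp⟩
  obtain rfl : c = -(m * a) := eq_neg_of_add_eq_zero_right hmc.symm
  obtain ⟨l, hl, hlu⟩ := (hmem u).mp ⟨1, K.one_mem, by simp⟩
  have hua : u = (l - m) * a := by rw [hlu]; noncomm_ring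
  have hlm : l - m ≠ 0 := by
    intro h
    rw [h, zero_mul] at hua
    exact hu.ne_zero hua
  obtain ⟨y, hy, -, hyl⟩ := hK _ (K.sub_mem hl hm) hlm
  have hau : a = y * u := by rw [hua, ← mul_assoc, hyl, one_mul]
  ext z
  constructor
  · intro hz
    obtain ⟨k, hk, rfl⟩ := (hmem z).mp hz
    refine ⟨(k - m) * y, K.mul_mem (K.sub_mem hk hm) hy, ?_⟩
    rw [mul_assoc, ← hau, sub_mul, sub_eq_add_neg]
  · rintro ⟨k, hk, rfl⟩
    refine (hmem _).mpr ⟨k * (l - m) + m, K.add_mem (K.mul_mem hk (K.sub_mem hl hm)) hm, ?_⟩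
    rw [add_mul, add_neg_cancel_right, mul_assoc, ← hua]
end
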